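/- Let Y be an ℝⁿ-valued centered Gaussian random vector with covariance matrix Q (that is, the law of Y is the multivariate Gaussian measure with mean 0 and covariance Q). Then for every η > 2n^{−1/2}, P( |‖Y‖₂² − E[‖Y‖₂²]| > 4nη‖Q‖₂ ) ≤ 2·exp(−n(η − 2n^{−1/2})²/2) + 2·exp(−n/2), where ‖Q‖₂ denotes the spectral (operator) norm of Q. -/

import Mathlib

open Matrix MeasureTheory ProbabilityTheory

/-- The spectral (operator) norm of a real matrix, induced by the Euclidean norm. -/
noncomputable def opNormR {n : Type*} [Fintype n] [DecidableEq n] (M : Matrix n n ℝ) : ℝ :=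
  ‖Matrix.toEuclideanCLM (𝕜 := ℝ) M‖

open scoped NNReal

lemma exp_neg_add_sq_le_one_sub {b : ℝ} (hb : |b| ≤ 1 / 2) :
    Real.exp (-(b + b ^ 2)) ≤ 1 - b := by
  obtain ⟨h₁, h₂⟩ := abs_le.mp hb
  rw [Real.exp_neg]
  refine inv_le_of_inv_le₀ (by linarith) ((inv_le_iff_one_le_mul₀' (by linarith)).2 ?_)
  rcases le_total 0 b with h | h
  · have hexp := Real.quadratic_le_exp_of_nonneg (x := b + b ^ 2) (by positivity)
    have hpoly : 1 ≤ (1 - b) * (1 + (b + b ^ 2) + (b + b ^ 2) ^ 2 / 2) := by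
      have : 0 ≤ (1 + b) ^ 2 * (1 - b) - 2 * b := by nlinarith [mul_nonneg h h]
      nlinarith [mul_nonneg (mul_nonneg h h) this]
    exact hpoly.trans (by gcongr; linarith)
  · have hexp := Real.add_one_le_exp (b + b ^ 2)
    have : 0 ≤ -b ^ 3 := by nlinarith [mul_nonneg (neg_nonneg.2 h) (sq_nonneg b)]
    nlinarith

lemma integral_exp_mul_sq_gaussianReal {v : ℝ≥0} {t : ℝ} (ht : 2 * t * v < 1) :
    ∫ x, Real.exp (t * x ^ 2) ∂(gaussianReal 0 v) = (√(1 - 2 * t * v))⁻¹ := by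
  rcases eq_or_ne v 0 with rfl | hv
  · simp
  have hv' : (0 : ℝ) < v := by positivity
  have hpdf (x : ℝ) : gaussianPDFReal 0 v x • Real.exp (t * x ^ 2)
      = (√(2 * Real.pi * v))⁻¹ * Real.exp (-((1 - 2 * t * v) / (2 * v)) * x ^ 2) := by
    rw [gaussianPDFReal, smul_eq_mul, mul_assoc, ← Real.exp_add]
    congr 2
    field_simp
    ring
  simp_rw [integral_gaussianReal_eq_integral_smul hv, hpdf, integral_const_mul]
  rw [integral_gaussian, ← Real.sqrt_inv, ← Real.sqrt_inv, ← Real.sqrt_mul (by positivity)]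
  congr 1
  have : 1 - 2 * t * v ≠ 0 := by linarith
  have := Real.pi_pos
  field_simp

lemma integrable_exp_mul_sq_gaussianReal {v : ℝ≥0} {t : ℝ} (ht : 2 * t * v < 1) :
    Integrable (fun x ↦ Real.exp (t * x ^ 2)) (gaussianReal 0 v) := by
  refine Integrable.of_integral_ne_zero ?_
  rw [integral_exp_mul_sq_gaussianReal ht]
  have : 0 < 1 - 2 * t * v := by linarith
  positivity

lemma integrable_exp_mul_sq_sub_gaussianReal {v : ℝ≥0} {t : ℝ} (ht : 2 * t * v < 1) :
    Integrable (fun x ↦ Real.exp (t * (x ^ 2 - v))) (gaussianReal 0 v) := by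
  simp_rw [mul_sub, sub_eq_add_neg, Real.exp_add]
  exact (integrable_exp_mul_sq_gaussianReal ht).mul_const _

lemma mgf_sq_sub_gaussianReal_le {v : ℝ≥0} {t : ℝ} (ht : |t * v| ≤ 1 / 4) :
    mgf (fun x ↦ x ^ 2 - v) (gaussianReal 0 v) t ≤ Real.exp (2 * (t * v) ^ 2) := by
  have ht' := (abs_le.mp ht).2
  have hlt : 2 * t * v < 1 := by linarith
  have hpos : 0 < 1 - 2 * t * v := by linarith
  have hmgf : mgf (fun x ↦ x ^ 2 - v) (gaussianReal 0 v) t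
      = (√(1 - 2 * t * v))⁻¹ * Real.exp (-(t * v)) := by
    simp_rw [mgf, mul_sub, sub_eq_add_neg, Real.exp_add, integral_mul_const]
    rw [integral_exp_mul_sq_gaussianReal hlt, ← sub_eq_add_neg]
  rw [hmgf, inv_mul_le_iff₀ (by positivity)]
  have hsqrt : Real.exp (-(t * v) - 2 * (t * v) ^ 2) ≤ √(1 - 2 * t * v) := by
    refine Real.le_sqrt_of_sq_le ?_
    have := exp_neg_add_sq_le_one_sub (b := 2 * (t * v))
      (by rw [abs_mul, abs_two]; linarith)
    rw [← Real.exp_nat_mul]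
    calc _ = Real.exp (-(2 * (t * v) + (2 * (t * v)) ^ 2)) := by push_cast; ring_nf
      _ ≤ _ := by linarith
  calc Real.exp (-(t * v))
      = Real.exp (-(t * v) - 2 * (t * v) ^ 2) * Real.exp (2 * (t * v) ^ 2) := by
        rw [← Real.exp_add]; ring_nf
    _ ≤ _ := by gcongr

section

variable {Ω ι : Type*} [MeasurableSpace Ω] [Fintype ι] {P : Measure Ω} [IsProbabilityMeasure P]
  {Z : ι → Ω → ℝ} {v : ι → ℝ≥0} {L y : ℝ}

lemma integrable_exp_mul_sum_sq_sub_and_mgf_le (hZ : ∀ i, Measurable (Z i))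
    (hlaw : ∀ i, P.map (Z i) = gaussianReal 0 (v i)) (hind : iIndepFun Z P)
    (hv : ∀ i, v i ≤ L) {t : ℝ} (ht : |t| * L ≤ 1 / 4) :
    Integrable (fun ω ↦ Real.exp (t * (∑ i, fun ω ↦ Z i ω ^ 2 - v i) ω)) P ∧
      mgf (∑ i, fun ω ↦ Z i ω ^ 2 - v i) P t
        ≤ Real.exp (2 * Fintype.card ι * (|t| * L) ^ 2) := by
  have htv (i) : |t * v i| ≤ |t| * L := by
    rw [abs_mul, NNReal.abs_eq]
    exact mul_le_mul_of_nonneg_left (hv i) (abs_nonneg t)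
  have hind' : iIndepFun (fun i ω ↦ Z i ω ^ 2 - (v i : ℝ)) P :=
    hind.comp (fun i x ↦ x ^ 2 - (v i : ℝ)) (by fun_prop)
  have hmeas (i) : Measurable fun ω ↦ Z i ω ^ 2 - (v i : ℝ) := by fun_prop
  constructor
  · refine hind'.integrable_exp_mul_sum hmeas fun i _ ↦ ?_
    have hlt : 2 * t * v i < 1 := by linarith [le_of_abs_le (htv i)]
    have h := integrable_exp_mul_sq_sub_gaussianReal hlt
    rw [← hlaw i] at h
    exact h.comp_measurable (hZ i)
  · rw [hind'.mgf_sum hmeas]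
    calc ∏ i, mgf (fun ω ↦ Z i ω ^ 2 - (v i : ℝ)) P t
        ≤ ∏ _i : ι, Real.exp (2 * (|t| * L) ^ 2) := by
          refine Finset.prod_le_prod (fun i _ ↦ mgf_nonneg) fun i _ ↦ ?_
          have h := mgf_sq_sub_gaussianReal_le ((htv i).trans ht)
          rw [← hlaw i, mgf, integral_map (hZ i).aemeasurable (by fun_prop)] at h
          refine h.trans (Real.exp_le_exp.2 ?_)
          rw [← sq_abs]
          gcongr
          exact htv i
      _ = _ := by
          rw [Finset.prod_const, ← Real.exp_nat_mul, Finset.card_univ]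
          ring_nf

lemma measureReal_le_abs_sum_sq_sub_le (hZ : ∀ i, Measurable (Z i))
    (hlaw : ∀ i, P.map (Z i) = gaussianReal 0 (v i)) (hind : iIndepFun Z P)
    (hv : ∀ i, v i ≤ L) (hL : 0 < L) (hy0 : 0 ≤ y) (hy1 : y ≤ 1) :
    P.real {ω | 4 * Fintype.card ι * y * L ≤ |∑ i, (Z i ω ^ 2 - v i)|}
      ≤ 2 * Real.exp (-(Fintype.card ι * y ^ 2) / 2) := by
  set W : Ω → ℝ := ∑ i, fun ω ↦ Z i ω ^ 2 - (v i : ℝ) with hW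
  set ε : ℝ := 4 * Fintype.card ι * y * L with hε
  have hsub : {ω | ε ≤ |∑ i, (Z i ω ^ 2 - v i)|} ⊆ {ω | ε ≤ W ω} ∪ {ω | W ω ≤ -ε} := by
    intro ω hω
    have hsum : ∑ i, (Z i ω ^ 2 - (v i : ℝ)) = W ω := by
      rw [hW, Finset.sum_apply]
    rw [Set.mem_ofPred_eq, hsum] at hω
    exact (le_abs.1 hω).imp id le_neg_of_le_neg
  set t : ℝ := y / (4 * L)
  have ht0 : 0 ≤ t := by positivity
  have htL : t * L = y / 4 := by simp only [t]; field_simp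
  have hexp : -t * ε + 2 * Fintype.card ι * (t * L) ^ 2 ≤ -(Fintype.card ι * y ^ 2) / 2 := by
    have : t * ε = 4 * Fintype.card ι * y * (t * L) := by rw [hε]; ring
    rw [neg_mul, this, htL]
    nlinarith [mul_nonneg (Nat.cast_nonneg (α := ℝ) (Fintype.card ι)) (sq_nonneg y)]
  have hup : P.real {ω | ε ≤ W ω} ≤ Real.exp (-(Fintype.card ι * y ^ 2) / 2) := by
    obtain ⟨hi, hm⟩ := integrable_exp_mul_sum_sq_sub_and_mgf_le hZ hlaw hind hv
      (t := t) (by rw [abs_of_nonneg ht0]; linarith)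
    rw [abs_of_nonneg ht0] at hm
    refine (measure_ge_le_exp_mul_mgf ε ht0 hi).trans ?_
    refine (mul_le_mul_of_nonneg_left hm (Real.exp_nonneg _)).trans ?_
    rw [← Real.exp_add]
    exact Real.exp_le_exp.2 hexp
  have hlow : P.real {ω | W ω ≤ -ε} ≤ Real.exp (-(Fintype.card ι * y ^ 2) / 2) := by
    obtain ⟨hi, hm⟩ := integrable_exp_mul_sum_sq_sub_and_mgf_le hZ hlaw hind hv
      (t := -t) (by rw [abs_neg, abs_of_nonneg ht0]; linarith)
    rw [abs_neg, abs_of_nonneg ht0] at hm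
    refine (measure_le_le_exp_mul_mgf (-ε) (neg_nonpos.2 ht0) hi).trans ?_
    refine (mul_le_mul_of_nonneg_left hm (Real.exp_nonneg _)).trans ?_
    rw [← Real.exp_add]
    exact Real.exp_le_exp.2 (by linarith)
  calc _ ≤ P.real ({ω | ε ≤ W ω} ∪ {ω | W ω ≤ -ε}) := measureReal_mono hsub
    _ ≤ _ := measureReal_union_le _ _
    _ ≤ _ := by linarith

end

lemma Matrix.IsHermitian.eigenvalues_le_opNormR {n : Type*} [Fintype n] [DecidableEq n]
    {Q : Matrix n n ℝ} (hQ : Q.IsHermitian) (i : n) : hQ.eigenvalues i ≤ opNormR Q := by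
  have h := (Matrix.toEuclideanCLM (𝕜 := ℝ) Q).le_opNorm (hQ.eigenvectorBasis i)
  have heig : Matrix.toEuclideanCLM (𝕜 := ℝ) Q (hQ.eigenvectorBasis i)
      = hQ.eigenvalues i • hQ.eigenvectorBasis i := by
    ext j
    simpa using congrFun (hQ.mulVec_eigenvectorBasis i) j
  rw [heig, norm_smul, hQ.eigenvectorBasis.norm_eq_one, mul_one, mul_one] at h
  exact (le_abs_self _).trans h

section

variable {Ω ι : Type*} [MeasurableSpace Ω] [Fintype ι] [DecidableEq ι] {P : Measure Ω}
  {Y : Ω → ι → ℝ} {Q : Matrix ι ι ℝ}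

lemma map_eigenvectorBasis_dotProduct (hQ : Q.PosSemidef)
    (hgauss : ∀ u : ι → ℝ, P.map (fun ω ↦ u ⬝ᵥ Y ω)
      = gaussianReal 0 (Real.toNNReal (u ⬝ᵥ (Q *ᵥ u)))) (i : ι) :
    P.map (fun ω ↦ ⇑(hQ.isHermitian.eigenvectorBasis i) ⬝ᵥ Y ω)
      = gaussianReal 0 (Real.toNNReal (hQ.isHermitian.eigenvalues i)) := by
  rw [hgauss, hQ.isHermitian.eigenvalues_eq i]
  simp

lemma iIndepFun_eigenvectorBasis_dotProduct [IsProbabilityMeasure P]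
    (hY : ∀ i, Measurable fun ω ↦ Y ω i)
    (hQ : Q.PosSemidef)
    (hgauss : ∀ u : ι → ℝ, P.map (fun ω ↦ u ⬝ᵥ Y ω)
      = gaussianReal 0 (Real.toNNReal (u ⬝ᵥ (Q *ᵥ u)))) :
    iIndepFun (fun i ω ↦ ⇑(hQ.isHermitian.eigenvectorBasis i) ⬝ᵥ Y ω) P := by
  set b := hQ.isHermitian.eigenvectorBasis with hb
  set l := hQ.isHermitian.eigenvalues with hl
  have hmeas (u : ι → ℝ) : Measurable fun ω ↦ u ⬝ᵥ Y ω := by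
    simp only [dotProduct]
    fun_prop
  rw [iIndepFun_iff_charFun_pi fun i ↦ (hmeas _).aemeasurable]
  intro t
  have hquad : (∑ i, t i • (b i).ofLp) ⬝ᵥ (Q *ᵥ (∑ i, t i • (b i).ofLp))
      = ∑ i, l i * t i ^ 2 := by
    have hbb (i j) : (b i).ofLp ⬝ᵥ (b j).ofLp = if i = j then 1 else 0 := by
      have := orthonormal_iff_ite.1 b.orthonormal j i
      simpa [EuclideanSpace.inner_eq_star_dotProduct, eq_comm] using this
    have hmul (i) : Q *ᵥ (b i).ofLp = l i • (b i).ofLp :=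
      hQ.isHermitian.mulVec_eigenvectorBasis i
    simp_rw [mulVec_sum, mulVec_smul, hmul, sum_dotProduct, dotProduct_sum, smul_dotProduct,
      dotProduct_smul, hbb]
    simp
    refine Finset.sum_congr rfl fun i _ ↦ by ring
  have hsum_nonneg : 0 ≤ ∑ i, l i * t i ^ 2 :=
    Finset.sum_nonneg fun i _ ↦ mul_nonneg (hQ.eigenvalues_nonneg i) (sq_nonneg _)
  have hjoint : charFun (P.map fun ω ↦ WithLp.toLp 2 fun i ↦ (b i).ofLp ⬝ᵥ Y ω) t
      = charFun (P.map fun ω ↦ (∑ i, t i • (b i).ofLp) ⬝ᵥ Y ω) 1 := by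
    rw [charFun_apply, charFun_apply_real, integral_map _ (by fun_prop),
      integral_map _ (by fun_prop)]
    · refine integral_congr_ae (.of_forall fun ω ↦ ?_)
      simp [PiLp.inner_apply, sum_dotProduct, mul_comm]
    · exact (hmeas _).aemeasurable
    · exact ((WithLp.measurable_toLp 2 _).comp
        (measurable_pi_lambda _ fun i ↦ hmeas _)).aemeasurable
  rw [hjoint, hgauss, hquad]
  simp_rw [hb, map_eigenvectorBasis_dotProduct hQ hgauss, charFun_gaussianReal]
  rw [← Complex.exp_sum]
  congr 1
  simp [Real.coe_toNNReal _ hsum_nonneg, Finset.sum_div, ← hl, Finset.sum_neg_distrib,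
    fun i ↦ max_eq_left (show 0 ≤ l i from hQ.eigenvalues_nonneg i)]

lemma sum_sq_eigenvectorBasis_dotProduct (hQ : Q.IsHermitian) (x : ι → ℝ) :
    ∑ i, (⇑(hQ.eigenvectorBasis i) ⬝ᵥ x) ^ 2 = ∑ i, x i ^ 2 := by
  have h := hQ.eigenvectorBasis.sum_sq_norm_inner_right (WithLp.toLp 2 x)
  simpa [EuclideanSpace.norm_sq_eq, EuclideanSpace.inner_eq_star_dotProduct, dotProduct_comm]
    using h

end

lemma integral_sq_of_map_eq_gaussianReal {Ω : Type*} [MeasurableSpace Ω] {P : Measure Ω}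
    {X : Ω → ℝ} {v : ℝ≥0} (hX : Measurable X) (h : P.map X = gaussianReal 0 v) :
    Integrable (fun ω ↦ X ω ^ 2) P ∧ ∫ ω, X ω ^ 2 ∂P = v := by
  have hsq : Integrable (fun x : ℝ ↦ x ^ 2) (gaussianReal 0 v) :=
    (memLp_id_gaussianReal 2).integrable_sq
  constructor
  · rw [← h] at hsq
    exact hsq.comp_measurable hX
  · have hvar := variance_fun_id_gaussianReal (μ := 0) (v := v)
    rw [variance_of_integral_eq_zero (by fun_prop) (by simp)] at hvar
    rw [← h, integral_map hX.aemeasurable (by fun_prop)] at hvar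
    exact hvar

/-- Negahban–Wainwright: if `Y` is an `ℝⁿ`-valued centered Gaussian vector
with covariance `Q` (i.e. every linear functional `u ⬝ Y` is `N(0, uᵀQu)`), then for every
`η > 2n^{−1/2}`,
`P(|‖Y‖₂² − E‖Y‖₂²| > 4nη‖Q‖₂) ≤ 2 exp(−n(η − 2n^{−1/2})²/2) + 2 exp(−n/2)`. -/
theorem stmt19 {n : ℕ} {Ω : Type*} [MeasurableSpace Ω] (P : Measure Ω)
    [IsProbabilityMeasure P]
    (Y : Ω → Fin n → ℝ) (hYmeas : ∀ i, Measurable fun ω => Y ω i)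
    (Q : Matrix (Fin n) (Fin n) ℝ) (hQ : Q.PosSemidef)
    (hgauss : ∀ u : Fin n → ℝ,
      Measure.map (fun ω => u ⬝ᵥ Y ω) P
        = gaussianReal 0 (Real.toNNReal (u ⬝ᵥ (Q *ᵥ u)))) :
    ∀ η : ℝ, 2 / Real.sqrt n < η →
      P {ω | 4 * n * η * opNormR Q
            < |(∑ i, Y ω i ^ 2) - ∫ ω', (∑ i, Y ω' i ^ 2) ∂P|}
        ≤ ENNReal.ofReal (2 * Real.exp (-(n * (η - 2 / Real.sqrt n) ^ 2) / 2)
            + 2 * Real.exp (-(n : ℝ) / 2)) := by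
  intro η hη
  set L := opNormR Q
  set Z : Fin n → Ω → ℝ := fun i ω ↦ ⇑(hQ.isHermitian.eigenvectorBasis i) ⬝ᵥ Y ω
  set v : Fin n → ℝ≥0 := fun i ↦ Real.toNNReal (hQ.isHermitian.eigenvalues i)
  have hZ (i) : Measurable (Z i) := by
    simp only [Z, dotProduct]
    fun_prop
  have hlaw (i) : P.map (Z i) = gaussianReal 0 (v i) :=
    map_eigenvectorBasis_dotProduct hQ hgauss i
  have hind : iIndepFun Z P := iIndepFun_eigenvectorBasis_dotProduct hYmeas hQ hgauss
  have hL0 : 0 ≤ L := norm_nonneg _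
  have hv (i) : v i ≤ L := by
    rw [Real.coe_toNNReal _ (hQ.eigenvalues_nonneg i)]
    exact hQ.isHermitian.eigenvalues_le_opNormR i
  have hdev (ω) : (∑ i, Y ω i ^ 2) - ∫ ω', (∑ i, Y ω' i ^ 2) ∂P = ∑ i, (Z i ω ^ 2 - v i) := by
    have hsq (ω) : ∑ i, Y ω i ^ 2 = ∑ i, Z i ω ^ 2 :=
      (sum_sq_eigenvectorBasis_dotProduct hQ.isHermitian (Y ω)).symm
    simp_rw [hsq]
    rw [integral_finsetSum _ fun i _ ↦ (integral_sq_of_map_eq_gaussianReal (hZ i) (hlaw i)).1,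
      Finset.sum_sub_distrib]
    simp_rw [fun i ↦ (integral_sq_of_map_eq_gaussianReal (hZ i) (hlaw i)).2]
  simp_rw [hdev]
  rcases hL0.eq_or_lt with hL | hL
  · refine le_of_eq_of_le ?_ zero_le
    have hzero (i) : ∀ᵐ ω ∂P, Z i ω ^ 2 - v i = 0 := by
      have hvi : v i = 0 := le_antisymm (by exact_mod_cast (hv i).trans hL.ge) zero_le
      have h : ∀ᵐ x ∂(P.map (Z i)), x = 0 := by
        rw [hlaw, hvi, gaussianReal_zero_var, ae_dirac_eq]
        exact Filter.eventually_pure.2 rfl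
      filter_upwards [ae_of_ae_map (hZ i).aemeasurable h] with ω hω
      simp [hω, hvi]
    have : ∀ᵐ ω ∂P, ¬ 4 * n * η * L < |∑ i, (Z i ω ^ 2 - v i)| := by
      filter_upwards [ae_all_iff.2 hzero] with ω hω
      simp [hω, ← hL]
    simpa [ae_iff] using this
  · set δ := η - 2 / √(n : ℝ)
    have hδ : 0 < δ := sub_pos.2 hη
    have hδη : δ ≤ η := sub_le_self _ (by positivity)
    have key := measureReal_le_abs_sum_sq_sub_le hZ hlaw hind hv hL
      (y := min δ 1) (by positivity) (min_le_right _ _)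
    rw [Fintype.card_fin] at key
    have hsub : {ω | 4 * n * η * L < |∑ i, (Z i ω ^ 2 - v i)|}
        ⊆ {ω | 4 * n * min δ 1 * L ≤ |∑ i, (Z i ω ^ 2 - v i)|} := fun ω hω ↦ by
      refine le_trans ?_ (le_of_lt (Set.mem_ofPred.1 hω))
      gcongr
      exact (min_le_left _ _).trans hδη
    refine (measure_mono hsub).trans ?_
    rw [← ofReal_measureReal]
    refine ENNReal.ofReal_le_ofReal (key.trans ?_)
    rcases min_choice δ 1 with h | h <;> rw [h]
    · exact le_add_of_nonneg_right (by positivity)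
    · rw [one_pow, mul_one]
      exact le_add_of_nonneg_left (by positivity)
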